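/- Let G be a finite simple graph with N ≥ 2 vertices, fix a vertex v ∈ V and a color k ∈ [q], and set Δ̃ = max_{u ∈ V, u ≠ v} deg_G(u). Then the spectral gap of the Swendsen–Wang dynamics satisfies λ(P) ≥ c̃_SW · λ(P_{Λ_v^k}²), where c̃_SW = (1/(2q²))·(q·e^{2β})^{−4Δ̃} and P_{Λ_v^k} is the single-site heat-bath chain on Λ_v^k defined in the context. -/

import Mathlib

open Finset

noncomputable section

/-- Number of connected components of the graph `(V, A)`, counting isolated vertices. -/
def numComp {V : Type*} (A : Finset (Sym2 V)) : ℕ :=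
  Nat.card (SimpleGraph.fromEdgeSet (↑A : Set (Sym2 V))).ConnectedComponent

/-- The set `E(σ)` of edges of `G` whose endpoints receive the same color under `σ`. -/
def monoEdges {V : Type*} [Fintype V] [DecidableEq V] (G : SimpleGraph V)
    [DecidableRel G.Adj] {q : ℕ} (σ : V → Fin q) : Finset (Sym2 V) :=
  G.edgeFinset.filter fun e => ∀ u ∈ e, ∀ w ∈ e, σ u = σ w

/-- The Swendsen–Wang transition matrix on `Ω_P = [q]^V`, with `p = 1 - e^{-β}`. -/
def SW {V : Type*} [Fintype V] [DecidableEq V] (G : SimpleGraph V) [DecidableRel G.Adj]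
    (β : ℝ) (q : ℕ) (σ τ : V → Fin q) : ℝ :=
  ∑ A ∈ (monoEdges G σ ∩ monoEdges G τ).powerset,
    (1 - Real.exp (-β)) ^ A.card * Real.exp (-β) ^ ((monoEdges G σ).card - A.card) *
      ((q : ℝ) ^ numComp A)⁻¹

/-- Partition function `Z(G,β,q)`. -/
def pottsZ {V : Type*} [Fintype V] [DecidableEq V] (G : SimpleGraph V) [DecidableRel G.Adj]
    (β : ℝ) (q : ℕ) : ℝ :=
  ∑ σ : V → Fin q, Real.exp (β * (monoEdges G σ).card)

/-- Boltzmann distribution `π_β` of the `q`-state Potts model on `G`. -/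
def potts {V : Type*} [Fintype V] [DecidableEq V] (G : SimpleGraph V) [DecidableRel G.Adj]
    (β : ℝ) (q : ℕ) (σ : V → Fin q) : ℝ :=
  Real.exp (β * (monoEdges G σ).card) / pottsZ G β q

/-- Heat-bath (single-site Glauber) transition matrix on `Ω_P`. -/
def HB {V : Type*} [Fintype V] [DecidableEq V] (G : SimpleGraph V) [DecidableRel G.Adj]
    (β : ℝ) (q : ℕ) (σ τ : V → Fin q) : ℝ :=
  ((Fintype.card V : ℝ))⁻¹ * ∑ v : V, ∑ k : Fin q,
    if τ = Function.update σ v k then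
      potts G β q (Function.update σ v k) / ∑ l : Fin q, potts G β q (Function.update σ v l)
    else 0

/-- `L₂(ν)`-norm of `f`. -/
def l2norm {Ω : Type*} [Fintype Ω] (ν : Ω → ℝ) (f : Ω → ℝ) : ℝ :=
  Real.sqrt (∑ x, f x ^ 2 * ν x)

/-- Operator norm of the matrix `M` acting on `L₂(ν)`. -/
def opNorm {Ω : Type*} [Fintype Ω] (ν : Ω → ℝ) (M : Ω → Ω → ℝ) : ℝ :=
  sSup {r : ℝ | ∃ f : Ω → ℝ, l2norm ν f ≤ 1 ∧ r = l2norm ν fun x => ∑ y, M x y * f y}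

/-- Spectral gap `λ(M) = 1 - ‖M - S_ν‖_ν` of a Markov kernel `M` reversible w.r.t. `ν`. -/
def specGap {Ω : Type*} [Fintype Ω] (ν : Ω → ℝ) (M : Ω → Ω → ℝ) : ℝ :=
  1 - opNorm ν fun x y => M x y - ν y

/-- Matrix product. -/
def matMul {Ω : Type*} [Fintype Ω] (M N : Ω → Ω → ℝ) : Ω → Ω → ℝ :=
  fun x y => ∑ z, M x z * N z y

end

noncomputable section

/-- Conditional Boltzmann distribution `π_β(·|Λ_v^k)` on `Λ_v^k = {σ : σ(v) = k}`. -/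
def condPotts {V : Type*} [Fintype V] [DecidableEq V] (G : SimpleGraph V) [DecidableRel G.Adj]
    (β : ℝ) (q : ℕ) (v : V) (k : Fin q) (σ : {σ : V → Fin q // σ v = k}) : ℝ :=
  potts G β q σ.1 / ∑ τ : {σ : V → Fin q // σ v = k}, potts G β q τ.1

/-- Off-diagonal entries of the single-site heat-bath chain on `Λ_v^k`:
`(1/(N-1))·(1 + π(σ)/π(τ))⁻¹` if `σ` and `τ` differ at exactly one vertex, `0` otherwise. -/
def PLamOff {V : Type*} [Fintype V] [DecidableEq V] (G : SimpleGraph V) [DecidableRel G.Adj]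
    (β : ℝ) (q : ℕ) (v : V) (k : Fin q) (σ τ : {σ : V → Fin q // σ v = k}) : ℝ :=
  if (Finset.univ.filter fun u => σ.1 u ≠ τ.1 u).card = 1 then
    ((Fintype.card V : ℝ) - 1)⁻¹ * (1 + potts G β q σ.1 / potts G β q τ.1)⁻¹
  else 0

/-- The single-site heat-bath chain `P_{Λ_v^k}` on `Λ_v^k`, with diagonal entries chosen so
that each row sums to `1`. -/
def PLam {V : Type*} [Fintype V] [DecidableEq V] (G : SimpleGraph V) [DecidableRel G.Adj]
    (β : ℝ) (q : ℕ) (v : V) (k : Fin q) (σ τ : {σ : V → Fin q // σ v = k}) : ℝ :=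
  if σ = τ then 1 - ∑ τ' ∈ Finset.univ.erase σ, PLamOff G β q v k σ τ'
  else PLamOff G β q v k σ τ

/-- Inner product of `L₂(ν)`. -/
def wInner {Ω : Type*} [Fintype Ω] (ν f g : Ω → ℝ) : ℝ := ∑ x, f x * g x * ν x

/-- Action of a kernel on functions. -/
def kernelAct {Ω : Type*} [Fintype Ω] (M : Ω → Ω → ℝ) (f : Ω → ℝ) : Ω → ℝ :=
  fun x => ∑ y, M x y * f y

/-- Detailed balance of `M` with respect to `ν`. -/
def DetailedBalance {Ω : Type*} (ν : Ω → ℝ) (M : Ω → Ω → ℝ) : Prop :=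
  ∀ x y, ν x * M x y = ν y * M y x

section Abstract

variable {Ω : Type*} [Fintype Ω] {ν : Ω → ℝ} {M : Ω → Ω → ℝ}

lemma l2norm_eq_sqrt_wInner (ν f : Ω → ℝ) : l2norm ν f = Real.sqrt (wInner ν f f) := by
  simp only [l2norm, wInner, sq]

lemma wInner_comm (ν f g : Ω → ℝ) : wInner ν f g = wInner ν g f :=
  sum_congr rfl fun x _ => by ring

lemma wInner_self_nonneg (hν : ∀ x, 0 ≤ ν x) (f : Ω → ℝ) : 0 ≤ wInner ν f f :=
  sum_nonneg fun x _ => mul_nonneg (mul_self_nonneg _) (hν x)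

lemma wInner_sq_le (hν : ∀ x, 0 ≤ ν x) (f g : Ω → ℝ) :
    wInner ν f g ^ 2 ≤ wInner ν f f * wInner ν g g :=
  sum_sq_le_sum_mul_sum_of_sq_le_mul _
    (fun x _ => mul_nonneg (mul_self_nonneg _) (hν x))
    (fun x _ => mul_nonneg (mul_self_nonneg _) (hν x)) fun x _ => le_of_eq (by ring)

lemma wInner_kernelAct (ν : Ω → ℝ) (M : Ω → Ω → ℝ) (f g : Ω → ℝ) :
    wInner ν (kernelAct M f) g = ∑ x, ∑ y, ν x * M x y * (f y * g x) := by
  simp only [wInner, kernelAct, sum_mul]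
  exact sum_congr rfl fun x _ => sum_congr rfl fun y _ => by ring

lemma DetailedBalance.wInner_kernelAct_symm (h : DetailedBalance ν M) (f g : Ω → ℝ) :
    wInner ν (kernelAct M f) g = wInner ν f (kernelAct M g) := by
  rw [wInner_comm ν f, wInner_kernelAct, wInner_kernelAct, sum_comm]
  exact sum_congr rfl fun x _ => sum_congr rfl fun y _ => by rw [h y x]; ring

lemma kernelAct_matMul (M N : Ω → Ω → ℝ) (f : Ω → ℝ) :
    kernelAct (matMul M N) f = kernelAct M (kernelAct N f) := by
  funext x
  simp only [kernelAct, matMul, sum_mul, mul_sum]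
  rw [sum_comm]
  exact sum_congr rfl fun x _ => sum_congr rfl fun y _ => by ring

/-- The Dirichlet form of a reversible kernel as a sum of squared increments. -/
lemma DetailedBalance.dirichlet_eq (h : DetailedBalance ν M) (h1 : ∀ x, ∑ y, M x y = 1)
    (f : Ω → ℝ) :
    wInner ν f f - wInner ν (kernelAct M f) f =
      (∑ x, ∑ y, ν x * M x y * (f x - f y) ^ 2) / 2 := by
  have ha : wInner ν f f = ∑ x, ∑ y, ν x * M x y * (f x * f x) := by
    refine sum_congr rfl fun x _ => ?_
    rw [← sum_mul, ← mul_sum, h1]; ring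
  have hb : wInner ν f f = ∑ x, ∑ y, ν x * M x y * (f y * f y) := by
    rw [ha, sum_comm]
    exact sum_congr rfl fun x _ => sum_congr rfl fun y _ => by rw [h y x]
  have hc : ∑ x, ∑ y, ν x * M x y * (f x - f y) ^ 2 =
      wInner ν f f + wInner ν f f - 2 * wInner ν (kernelAct M f) f := by
    nth_rewrite 1 [ha]
    rw [hb, wInner_kernelAct, mul_sum, ← sum_add_distrib, ← sum_sub_distrib]
    refine sum_congr rfl fun x _ => ?_
    rw [mul_sum, ← sum_add_distrib, ← sum_sub_distrib]
    exact sum_congr rfl fun y _ => by ring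
  rw [hc]; ring

lemma opNorm_nonneg (ν : Ω → ℝ) (M : Ω → Ω → ℝ) : 0 ≤ opNorm ν M :=
  Real.sSup_nonneg fun _ ⟨_, _, hr⟩ => hr ▸ Real.sqrt_nonneg _

lemma specGap_le_one (ν : Ω → ℝ) (M : Ω → Ω → ℝ) : specGap ν M ≤ 1 :=
  sub_le_self _ (opNorm_nonneg _ _)

lemma opNorm_le {c : ℝ} (hc : 0 ≤ c)
    (h : ∀ f, wInner ν (kernelAct M f) (kernelAct M f) ≤ c ^ 2 * wInner ν f f) :
    opNorm ν M ≤ c := by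
  refine Real.sSup_le ?_ hc
  rintro r ⟨f, hf, rfl⟩
  rw [l2norm_eq_sqrt_wInner] at hf ⊢
  refine Real.sqrt_le_iff.2 ⟨hc, (h f).trans ?_⟩
  have : wInner ν f f ≤ 1 := by simpa using (Real.sqrt_le_iff.1 hf).2
  nlinarith [sq_nonneg c]

lemma wInner_kernelAct_le_const (hν : ∀ x, 0 < ν x) (M : Ω → Ω → ℝ) (f : Ω → ℝ) :
    wInner ν (kernelAct M f) (kernelAct M f) ≤
      (∑ x, (∑ y, M x y ^ 2 / ν y) * ν x) * wInner ν f f := by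
  rw [sum_mul]
  refine sum_le_sum fun x _ => ?_
  have : kernelAct M f x ^ 2 ≤ (∑ y, M x y ^ 2 / ν y) * wInner ν f f :=
    sum_sq_le_sum_mul_sum_of_sq_le_mul _
      (fun y _ => div_nonneg (sq_nonneg _) (hν y).le)
      (fun y _ => mul_nonneg (mul_self_nonneg _) (hν y).le) fun y _ => le_of_eq <| by
        have := (hν y).ne'
        field_simp
  nlinarith [hν x]

lemma wInner_kernelAct_le_opNorm (hν : ∀ x, 0 < ν x) (M : Ω → Ω → ℝ) (f : Ω → ℝ) :
    wInner ν (kernelAct M f) (kernelAct M f) ≤ opNorm ν M ^ 2 * wInner ν f f := by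
  have hb : BddAbove {r : ℝ | ∃ f : Ω → ℝ, l2norm ν f ≤ 1 ∧
      r = l2norm ν fun x => ∑ y, M x y * f y} := by
    refine ⟨Real.sqrt (∑ x, (∑ y, M x y ^ 2 / ν y) * ν x), ?_⟩
    rintro r ⟨f, hf, rfl⟩
    rw [l2norm_eq_sqrt_wInner] at hf ⊢
    refine Real.sqrt_le_sqrt ((wInner_kernelAct_le_const hν M f).trans ?_)
    have : wInner ν f f ≤ 1 := by simpa using (Real.sqrt_le_iff.1 hf).2
    have h0 : 0 ≤ ∑ x, (∑ y, M x y ^ 2 / ν y) * ν x := sum_nonneg fun x _ =>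
      mul_nonneg (sum_nonneg fun y _ => div_nonneg (sq_nonneg _) (hν y).le) (hν x).le
    nlinarith
  rcases (wInner_self_nonneg (fun x => (hν x).le) f).eq_or_lt with h0 | hpos
  · have := wInner_kernelAct_le_const hν M f
    rw [← h0, mul_zero] at this ⊢
    exact this
  · set s := Real.sqrt (wInner ν f f) with hs
    have hs0 : 0 < s := Real.sqrt_pos.2 hpos
    have hs2 : s ^ 2 = wInner ν f f := Real.sq_sqrt hpos.le
    have hscale : ∀ g : Ω → ℝ, wInner ν (fun x => s⁻¹ * g x) (fun x => s⁻¹ * g x) =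
        wInner ν g g / s ^ 2 := fun g => by
      simp only [wInner, sum_div]
      exact sum_congr rfl fun x _ => by field_simp
    have hact : (fun x => ∑ y, M x y * (s⁻¹ * f y)) = fun x => s⁻¹ * kernelAct M f x := by
      funext x
      rw [kernelAct, mul_sum]
      exact sum_congr rfl fun y _ => by ring
    have hle := le_csSup hb ⟨fun x => s⁻¹ * f x, ?_, rfl⟩
    · rw [hact, l2norm_eq_sqrt_wInner, hscale, Real.sqrt_le_iff, div_le_iff₀ (by positivity),
        hs2] at hle
      exact hle.2
    · rw [l2norm_eq_sqrt_wInner, hscale, hs2, div_self hpos.ne', Real.sqrt_one]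

/-- A positive semidefinite symmetric operator whose quadratic form is bounded by `c` has
norm at most `c`. -/
lemma opNorm_le_of_form_le (hν : ∀ x, 0 ≤ ν x) (hM : DetailedBalance ν M) {c : ℝ} (hc : 0 ≤ c)
    (hpos : ∀ f, 0 ≤ wInner ν (kernelAct M f) f)
    (hle : ∀ f, wInner ν (kernelAct M f) f ≤ c * wInner ν f f) : opNorm ν M ≤ c := by
  refine opNorm_le hc fun f => ?_
  set g := kernelAct M f with hg
  have hexp : ∀ s : ℝ, wInner ν (kernelAct M fun x => f x - s * g x) (fun x => f x - s * g x) =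
      wInner ν g f - 2 * s * wInner ν g g + s ^ 2 * wInner ν (kernelAct M g) g := fun s => by
    have h1 : (kernelAct M fun x => f x - s * g x) = fun x => g x - s * kernelAct M g x := by
      funext x
      rw [hg, kernelAct, kernelAct, kernelAct, mul_sum, ← sum_sub_distrib]
      exact sum_congr rfl fun y _ => by ring
    have h2 : wInner ν (kernelAct M g) f = wInner ν g g := by
      rw [hM.wInner_kernelAct_symm]
    have h3 : 2 * s * wInner ν g g = s * wInner ν g g + s * wInner ν (kernelAct M g) f := by
      rw [h2]; ring
    rw [h1, h3]
    simp only [wInner, mul_sum, ← sum_add_distrib, ← sum_sub_distrib]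
    exact sum_congr rfl fun x _ => by ring
  have h0 := wInner_self_nonneg hν f
  have hG := wInner_self_nonneg hν g
  rcases hc.eq_or_lt with rfl | hc
  · have h1 := hexp 1 ▸ hpos (fun x => f x - 1 * g x)
    have := hle g
    have := hle f
    nlinarith
  · have h1 := hexp c⁻¹ ▸ hpos (fun x => f x - c⁻¹ * g x)
    have h2 : c⁻¹ ^ 2 * wInner ν (kernelAct M g) g ≤ c⁻¹ * wInner ν g g := by
      have := mul_le_mul_of_nonneg_left (hle g) (by positivity : 0 ≤ c⁻¹ ^ 2)
      refine this.trans_eq ?_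
      field_simp
    have h3 : c⁻¹ * wInner ν g g ≤ c * wInner ν f f := by linarith [hle f]
    rw [inv_mul_le_iff₀ hc] at h3
    linarith

/-- If conjugating `R` by a symmetric stochastic-like kernel `H` increases entries by at most a
factor `C`, the spectral gap of `H²` is controlled by the Dirichlet form of `R`. -/
lemma specGap_mul_le_dirichlet (hν : ∀ x, 0 < ν x) {H R : Ω → Ω → ℝ}
    (hH : DetailedBalance ν H) (hR : DetailedBalance ν R) (hH1 : ∀ x, ∑ y, H x y = 1)
    (hR1 : ∀ x, ∑ y, R x y = 1) (hR0 : ∀ x y, 0 ≤ R x y) {C : ℝ}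
    (hC : ∀ x y, matMul H (matMul R H) x y ≤ C * R x y) {g : Ω → ℝ} (hg : ∑ x, ν x * g x = 0) :
    specGap ν (matMul H H) * wInner ν g g ≤
      C * (wInner ν g g - wInner ν (kernelAct R g) g) := by
  have hν' : ∀ x, 0 ≤ ν x := fun x => (hν x).le
  have hQact : ∀ f, kernelAct (matMul H (matMul R H)) f =
      kernelAct H (kernelAct R (kernelAct H f)) := fun f => by
    rw [kernelAct_matMul, kernelAct_matMul]
  have hone : ∀ N : Ω → Ω → ℝ, (∀ x, ∑ y, N x y = 1) ↔ kernelAct N 1 = 1 := fun N => by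
    simp [funext_iff, kernelAct]
  have hQ1 : ∀ x, ∑ y, matMul H (matMul R H) x y = 1 := by
    rw [hone] at hH1 hR1 ⊢
    rw [hQact, hH1, hR1, hH1]
  have hQ : DetailedBalance ν (matMul H (matMul R H)) := fun x y => by
    simp only [matMul, mul_sum]
    rw [sum_comm]
    refine sum_congr rfl fun a _ => sum_congr rfl fun b _ => ?_
    calc ν x * (H x b * (R b a * H a y)) = ν x * H x b * R b a * H a y := by ring
      _ = ν b * R b a * H b x * H a y := by rw [hH x b]; ring
      _ = ν a * H a y * R a b * H b x := by rw [hR b a]; ring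
      _ = ν y * (H y a * (R a b * H b x)) := by rw [hH a y]; ring
  set h := kernelAct H g with hh
  have hQR : wInner ν g g - wInner ν (kernelAct (matMul H (matMul R H)) g) g ≤
      C * (wInner ν g g - wInner ν (kernelAct R g) g) := by
    rw [hQ.dirichlet_eq hQ1, hR.dirichlet_eq hR1, ← mul_div_assoc, mul_sum]
    refine div_le_div_of_nonneg_right (sum_le_sum fun x _ => ?_) zero_le_two
    rw [mul_sum]
    refine sum_le_sum fun y _ => ?_
    have := mul_le_mul_of_nonneg_left (hC x y) (mul_nonneg (hν' x) (sq_nonneg (g x - g y)))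
    linarith
  have hQh : wInner ν (kernelAct (matMul H (matMul R H)) g) g = wInner ν (kernelAct R h) h := by
    rw [hQact, hH.wInner_kernelAct_symm]
  have hRh : wInner ν (kernelAct R h) h ≤ wInner ν h h := by
    have := hR.dirichlet_eq hR1 h
    have h2 : 0 ≤ ∑ x, ∑ y, ν x * R x y * (h x - h y) ^ 2 := sum_nonneg fun x _ =>
      sum_nonneg fun y _ => mul_nonneg (mul_nonneg (hν' x) (hR0 x y)) (sq_nonneg _)
    linarith
  have hgap : wInner ν h h ≤ (1 - specGap ν (matMul H H)) * wInner ν g g := by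
    set T : Ω → Ω → ℝ := fun x y => matMul H H x y - ν y with hT
    have hTg : kernelAct T g = kernelAct H h := by
      rw [hh, ← kernelAct_matMul]
      funext x
      simp only [kernelAct, hT, sub_mul, sum_sub_distrib, hg, sub_zero]
    have hop : 1 - specGap ν (matMul H H) = opNorm ν T := by simp [specGap, hT]
    have h1 := wInner_kernelAct_le_opNorm hν T g
    have h2 := wInner_sq_le hν' (kernelAct T g) g
    have h3 : wInner ν (kernelAct T g) g = wInner ν h h := by
      rw [hTg, hH.wInner_kernelAct_symm]
    have h0 := wInner_self_nonneg hν' g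
    rw [h3] at h2
    rw [hop]
    refine abs_le_of_sq_le_sq' ?_ (mul_nonneg (opNorm_nonneg _ _) h0) |>.2
    nlinarith
  rw [hQh] at hQR
  linarith

/-- Entrywise comparison of `H R H` with `R` when `R` varies by at most a factor `K` along the
transitions of `H`. -/
lemma matMul_conj_le (hν : ∀ x, 0 < ν x) {H R : Ω → Ω → ℝ}
    (hH : DetailedBalance ν H) (hR : DetailedBalance ν R) (hR0 : ∀ x y, 0 ≤ R x y) {K L : ℝ}
    (hK : 0 ≤ K) (hL : ∀ x, ∑ y, |H x y| ≤ L)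
    (hHR : ∀ x x' y, H x x' ≠ 0 → R x' y ≤ K * R x y) (x y : Ω) :
    matMul H (matMul R H) x y ≤ (L * K) ^ 2 * R x y := by
  have h1 : ∀ x y, ∑ a, |H x a| * R a y ≤ L * K * R x y := fun x y => by
    calc ∑ a, |H x a| * R a y ≤ ∑ a, |H x a| * (K * R x y) := sum_le_sum fun a _ => by
          by_cases h : H x a = 0
          · simp [h]
          · exact mul_le_mul_of_nonneg_left (hHR x a y h) (abs_nonneg _)
      _ ≤ L * K * R x y := by
          rw [← sum_mul, mul_assoc]
          exact mul_le_mul_of_nonneg_right (hL x) (mul_nonneg hK (hR0 x y))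
  have h3 : ∀ a, |matMul R H a y| ≤ L * K * R a y := fun a => by
    refine le_of_mul_le_mul_left ?_ (hν a)
    have : ν a * matMul R H a y = ν y * ∑ b, H y b * R b a := by
      rw [matMul, mul_sum, mul_sum]
      refine sum_congr rfl fun b _ => ?_
      rw [← mul_assoc, hR a b, mul_right_comm, hH b y, mul_assoc]
    calc ν a * |matMul R H a y| = ν y * |∑ b, H y b * R b a| := by
          have := congrArg abs this
          rwa [abs_mul, abs_mul, abs_of_pos (hν a), abs_of_pos (hν y)] at this
      _ ≤ ν y * (L * K * R y a) := by
          refine mul_le_mul_of_nonneg_left ((abs_sum_le_sum_abs _ _).trans ?_) (hν y).le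
          simpa only [abs_mul, abs_of_nonneg (hR0 _ _)] using h1 y a
      _ = ν a * (L * K * R a y) := by rw [mul_left_comm, hR y a, mul_left_comm]
  have hL0 : 0 ≤ L := (sum_nonneg fun y _ => abs_nonneg (H x y)).trans (hL x)
  calc matMul H (matMul R H) x y ≤ ∑ a, |H x a| * (L * K * R a y) := by
        refine sum_le_sum fun a _ => (le_abs_self _).trans ?_
        rw [abs_mul]
        exact mul_le_mul_of_nonneg_left (h3 a) (abs_nonneg _)
    _ = L * K * ∑ a, |H x a| * R a y := by
        rw [mul_sum]
        exact sum_congr rfl fun a _ => by ring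
    _ ≤ L * K * (L * K * R x y) :=
        mul_le_mul_of_nonneg_left (h1 x y) (mul_nonneg hL0 hK)
    _ = _ := by ring

end Abstract

section Potts

/-- Random-cluster weight of the edge subsets of `X`, with edge weight `a`. -/
def clusterSum {V : Type*} (q : ℕ) (a : ℝ) (X : Finset (Sym2 V)) : ℝ :=
  ∑ A ∈ X.powerset, a ^ A.card * ((q : ℝ) ^ numComp A)⁻¹

lemma clusterSum_nonneg {V : Type*} (q : ℕ) {a : ℝ} (ha : 0 ≤ a) (X : Finset (Sym2 V)) :
    0 ≤ clusterSum q a X :=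
  sum_nonneg fun _ _ => by positivity

lemma clusterSum_mono {V : Type*} (q : ℕ) {a : ℝ} (ha : 0 ≤ a) {X Y : Finset (Sym2 V)} (h : X ⊆ Y) :
    clusterSum q a X ≤ clusterSum q a Y :=
  sum_le_sum_of_subset_of_nonneg (powerset_mono.2 h) fun _ _ _ => by positivity

variable {V : Type*} [Fintype V] [DecidableEq V]

/-- The colorings that are constant along every edge of `A`. -/
def constColorings (q : ℕ) (A : Finset (Sym2 V)) : Finset (V → Fin q) :=
  univ.filter fun τ => ∀ x y, s(x, y) ∈ A → τ x = τ y

lemma card_constColorings (q : ℕ) (A : Finset (Sym2 V)) :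
    (constColorings q A).card = q ^ numComp A := by
  classical
  set H := SimpleGraph.fromEdgeSet (↑A : Set (Sym2 V)) with hH
  have hconst : ∀ τ ∈ constColorings q A, ∀ (x y : V) (p : H.Walk x y), τ x = τ y := by
    intro τ hτ x y p
    induction p with
    | nil => rfl
    | cons h _ ih =>
      refine Eq.trans ?_ ih
      exact (mem_filter.1 hτ).2 _ _ (by simpa using ((SimpleGraph.fromEdgeSet_adj _).1 h).1)
  have e : {τ // τ ∈ constColorings q A} ≃ (H.ConnectedComponent → Fin q) :=
    { toFun := fun τ c => c.lift τ.1 fun x y p _ => hconst τ.1 τ.2 x y p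
      invFun := fun f => ⟨fun x => f (H.connectedComponentMk x), by
        refine mem_filter.2 ⟨mem_univ _, fun x y hxy => ?_⟩
        by_cases h : x = y
        · rw [h]
        · have : H.Adj x y := (SimpleGraph.fromEdgeSet_adj _).2 ⟨by simpa using hxy, h⟩
          exact congrArg f (SimpleGraph.ConnectedComponent.eq.2 this.reachable)⟩
      left_inv := fun τ => by ext x; rfl
      right_inv := fun f => by
        funext c
        induction c using SimpleGraph.ConnectedComponent.ind with
        | h x => rfl }
  rw [← Fintype.card_coe, ← Nat.card_eq_fintype_card, Nat.card_congr e, Nat.card_fun,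
    Nat.card_fin, numComp]

lemma pow_numComp_le_insert (q : ℕ) [NeZero q] (e : Sym2 V) (A : Finset (Sym2 V)) :
    q ^ numComp A ≤ q * q ^ numComp (insert e A) := by
  induction e using Sym2.ind with
  | h x y =>
  rw [← card_constColorings, ← card_constColorings, mul_comm]
  have h := card_le_mul_card_image_of_maps_to (s := constColorings q A)
    (t := (univ : Finset (Fin q))) (f := fun τ => τ x - τ y) (fun _ _ => mem_univ _)
    (constColorings q (insert s(x, y) A)).card fun c _ => ?_
  · simpa using h
  rcases (filter (fun τ : V → Fin q => τ x - τ y = c) (constColorings q A)).eq_empty_or_nonempty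
    with h0 | ⟨τ₀, h0⟩
  · simp [h0]
  refine card_le_card_of_injOn (fun τ => τ - τ₀) (fun τ hτ => ?_)
    (fun a _ b _ hab => sub_left_injective hab)
  simp only [constColorings, mem_filter, mem_univ, true_and, mem_coe] at h0 hτ ⊢
  intro z w hzw
  simp only [mem_insert, Sym2.eq_iff] at hzw
  have hxy : τ x - τ₀ x = τ y - τ₀ y := by
    rw [sub_eq_sub_iff_sub_eq_sub, hτ.2, h0.2]
  rcases hzw with (⟨rfl, rfl⟩ | ⟨rfl, rfl⟩) | hzw
  · simpa using hxy
  · simpa using hxy.symm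
  · simp [hτ.1 z w hzw, h0.1 z w hzw]

lemma clusterSum_insert_le (q : ℕ) [NeZero q] {a : ℝ} (ha : 0 ≤ a) (e : Sym2 V)
    (X : Finset (Sym2 V)) :
    clusterSum q a (insert e X) ≤ (q * (1 + a)) * clusterSum q a X := by
  have hq : (1 : ℝ) ≤ q := by exact_mod_cast NeZero.one_le
  by_cases he : e ∈ X
  · rw [insert_eq_of_mem he]
    refine le_mul_of_one_le_left (clusterSum_nonneg q ha X) ?_
    nlinarith
  have hle : ∑ A ∈ X.powerset, a ^ (insert e A).card * ((q : ℝ) ^ numComp (insert e A))⁻¹ ≤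
      (a * q) * clusterSum q a X := by
    rw [clusterSum, mul_sum]
    refine sum_le_sum fun A hA => ?_
    rw [card_insert_of_notMem fun h => he (mem_powerset.1 hA h), pow_succ]
    have h1 : (q : ℝ) ^ numComp A ≤ q * (q : ℝ) ^ numComp (insert e A) := by
      exact_mod_cast pow_numComp_le_insert q e A
    have h2 : ((q : ℝ) ^ numComp (insert e A))⁻¹ ≤ q * ((q : ℝ) ^ numComp A)⁻¹ := by
      rw [← div_eq_mul_inv, le_div_iff₀ (by positivity), inv_mul_le_iff₀ (by positivity)]
      linarith
    calc a ^ A.card * a * ((q : ℝ) ^ numComp (insert e A))⁻¹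
        ≤ a ^ A.card * a * (q * ((q : ℝ) ^ numComp A)⁻¹) := by gcongr
      _ = _ := by ring
  rw [clusterSum, sum_powerset_insert he]
  have := clusterSum_nonneg q ha X
  change clusterSum q a X + _ ≤ _
  nlinarith

lemma clusterSum_union_le (q : ℕ) [NeZero q] {a : ℝ} (ha : 0 ≤ a) (X Y : Finset (Sym2 V)) :
    clusterSum q a (X ∪ Y) ≤ (q * (1 + a)) ^ Y.card * clusterSum q a X := by
  induction Y using Finset.induction_on with
  | empty => simp
  | insert e Y he ih =>
    rw [union_insert, card_insert_of_notMem he, pow_succ', mul_assoc]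
    exact (clusterSum_insert_le q ha e _).trans (by gcongr)

variable (G : SimpleGraph V) [DecidableRel G.Adj] {q : ℕ}

lemma subset_monoEdges_iff {A : Finset (Sym2 V)} (hA : A ⊆ G.edgeFinset) (σ : V → Fin q) :
    A ⊆ monoEdges G σ ↔ σ ∈ constColorings q A := by
  simp only [monoEdges, constColorings, mem_filter, mem_univ, true_and, subset_iff]
  constructor
  · intro h x y hxy
    exact (h hxy).2 x (by simp) y (by simp)
  · intro h e he
    refine ⟨hA he, fun u hu w hw => ?_⟩
    induction e using Sym2.ind with
    | h x y =>
      have := h x y he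
      rcases Sym2.mem_iff.1 hu with rfl | rfl <;> rcases Sym2.mem_iff.1 hw with rfl | rfl <;>
        simp [this]

lemma monoEdges_subset (σ : V → Fin q) : monoEdges G σ ⊆ G.edgeFinset := filter_subset _ _

lemma monoEdges_add_const [NeZero q] (σ : V → Fin q) (g : Fin q) :
    monoEdges G (fun x => σ x + g) = monoEdges G σ := by
  simp [monoEdges]

lemma SW_eq (β : ℝ) (σ τ : V → Fin q) :
    SW G β q σ τ = Real.exp (-(β * (monoEdges G σ).card)) *
      clusterSum q (Real.exp β - 1) (monoEdges G σ ∩ monoEdges G τ) := by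
  rw [SW, clusterSum, mul_sum]
  refine sum_congr rfl fun A hA => ?_
  have hle : A.card ≤ (monoEdges G σ).card :=
    card_le_card ((mem_powerset.1 hA).trans inter_subset_left)
  have h1 : 1 - Real.exp (-β) = Real.exp (-β) * (Real.exp β - 1) := by
    rw [mul_sub, ← Real.exp_add]; simp
  have h2 : Real.exp (-(β * (monoEdges G σ).card)) =
      Real.exp (-β) ^ A.card * Real.exp (-β) ^ ((monoEdges G σ).card - A.card) := by
    rw [← pow_add, Nat.add_sub_cancel' hle, ← Real.exp_nat_mul]
    ring_nf
  rw [h1, h2, mul_pow]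
  ring

lemma pottsZ_pos [NeZero q] (β : ℝ) : 0 < pottsZ G β q :=
  sum_pos (fun _ _ => Real.exp_pos _) univ_nonempty

lemma potts_pos [NeZero q] (β : ℝ) (σ : V → Fin q) : 0 < potts G β q σ :=
  div_pos (Real.exp_pos _) (pottsZ_pos G β)

lemma sum_potts [NeZero q] (β : ℝ) : ∑ σ, potts G β q σ = 1 := by
  simp only [potts]
  rw [← sum_div]
  exact div_self (pottsZ_pos G β).ne'

lemma potts_mul_SW (β : ℝ) (σ τ : V → Fin q) :
    potts G β q σ * SW G β q σ τ =
      clusterSum q (Real.exp β - 1) (monoEdges G σ ∩ monoEdges G τ) / pottsZ G β q := by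
  rw [SW_eq, potts, Real.exp_neg]
  have := (Real.exp_pos (β * (monoEdges G σ).card)).ne'
  field_simp

lemma detailedBalance_SW (β : ℝ) : DetailedBalance (potts G β q) (SW G β q) := fun σ τ => by
  rw [potts_mul_SW, potts_mul_SW, inter_comm]

lemma exp_sub_one_nonneg {β : ℝ} (hβ : 0 ≤ β) : 0 ≤ Real.exp β - 1 :=
  sub_nonneg.2 (Real.one_le_exp hβ)

lemma SW_nonneg {β : ℝ} (hβ : 0 ≤ β) (σ τ : V → Fin q) : 0 ≤ SW G β q σ τ := by
  rw [SW_eq]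
  exact mul_nonneg (Real.exp_pos _).le (clusterSum_nonneg q (exp_sub_one_nonneg hβ) _)

lemma clusterSum_inter_eq (a : ℝ) (σ τ : V → Fin q) :
    clusterSum q a (monoEdges G σ ∩ monoEdges G τ) =
      ∑ A ∈ G.edgeFinset.powerset, a ^ A.card * ((q : ℝ) ^ numComp A)⁻¹ *
        ((if σ ∈ constColorings q A then 1 else 0) *
          if τ ∈ constColorings q A then 1 else 0) := by
  have hset : (monoEdges G σ ∩ monoEdges G τ).powerset =
      G.edgeFinset.powerset.filter
        fun A => σ ∈ constColorings q A ∧ τ ∈ constColorings q A := by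
    ext A
    simp only [mem_powerset, mem_filter, subset_inter_iff]
    constructor
    · intro h
      have hA := h.1.trans (monoEdges_subset G σ)
      exact ⟨hA, (subset_monoEdges_iff G hA σ).1 h.1, (subset_monoEdges_iff G hA τ).1 h.2⟩
    · rintro ⟨hA, h1, h2⟩
      exact ⟨(subset_monoEdges_iff G hA σ).2 h1, (subset_monoEdges_iff G hA τ).2 h2⟩
  rw [clusterSum, hset, sum_filter]
  refine sum_congr rfl fun A _ => ?_
  by_cases h1 : σ ∈ constColorings q A <;> by_cases h2 : τ ∈ constColorings q A <;> simp [h1, h2]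

lemma sum_SW [NeZero q] (β : ℝ) (σ : V → Fin q) : ∑ τ, SW G β q σ τ = 1 := by
  have hq : (q : ℝ) ≠ 0 := by exact_mod_cast NeZero.ne q
  have h : ∑ τ : V → Fin q, clusterSum q (Real.exp β - 1) (monoEdges G σ ∩ monoEdges G τ) =
      ∑ A ∈ (monoEdges G σ).powerset, (Real.exp β - 1) ^ A.card := by
    have hset : (monoEdges G σ).powerset =
        G.edgeFinset.powerset.filter fun A => σ ∈ constColorings q A := by
      ext A
      simp only [mem_powerset, mem_filter]
      exact ⟨fun h => ⟨h.trans (monoEdges_subset G σ),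
        (subset_monoEdges_iff G (h.trans (monoEdges_subset G σ)) σ).1 h⟩,
        fun h => (subset_monoEdges_iff G h.1 σ).2 h.2⟩
    simp only [clusterSum_inter_eq]
    rw [sum_comm, hset, sum_filter]
    refine sum_congr rfl fun A _ => ?_
    rw [← mul_sum, ← mul_sum, sum_boole, filter_mem_eq_inter, univ_inter, card_constColorings]
    split_ifs <;> simp [hq]
  simp only [SW_eq]
  rw [← mul_sum, h]
  have := sum_pow_mul_eq_add_pow (Real.exp β - 1) 1 (monoEdges G σ)
  simp only [one_pow, mul_one, sub_add_cancel] at this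
  rw [this, ← Real.exp_nat_mul, ← Real.exp_add, mul_comm]
  simp

lemma SW_form_nonneg [NeZero q] {β : ℝ} (hβ : 0 ≤ β) (f : (V → Fin q) → ℝ) :
    0 ≤ wInner (potts G β q) (kernelAct (SW G β q) f) f := by
  have h : wInner (potts G β q) (kernelAct (SW G β q) f) f =
      (∑ A ∈ G.edgeFinset.powerset, (Real.exp β - 1) ^ A.card * ((q : ℝ) ^ numComp A)⁻¹ *
        (∑ σ, f σ * if σ ∈ constColorings q A then 1 else 0) ^ 2) / pottsZ G β q := by
    rw [wInner_kernelAct]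
    simp only [potts_mul_SW, clusterSum_inter_eq, sq, sum_mul_sum]
    simp only [mul_sum, sum_div, sum_mul]
    rw [sum_comm (s := G.edgeFinset.powerset)]
    refine sum_congr rfl fun σ _ => ?_
    rw [sum_comm]
    refine sum_congr rfl fun A _ => sum_congr rfl fun τ _ => ?_
    ring
  rw [h]
  have := exp_sub_one_nonneg hβ
  exact div_nonneg (sum_nonneg fun A _ => by positivity) (pottsZ_pos G β).le

lemma SW_le_of_eq_off [NeZero q] {β : ℝ} (hβ : 0 ≤ β) {u : V} {σ σ' : V → Fin q}
    (h : ∀ x, x ≠ u → σ x = σ' x) (τ : V → Fin q) :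
    SW G β q σ' τ ≤ (q * Real.exp (2 * β)) ^ G.degree u * SW G β q σ τ := by
  have hsub : ∀ {σ σ' : V → Fin q}, (∀ x, x ≠ u → σ x = σ' x) →
      monoEdges G σ' ⊆ monoEdges G σ ∪ G.incidenceFinset u := by
    intro σ σ' h e he
    rw [mem_union, G.incidenceFinset_eq_filter, mem_filter]
    by_cases hu : u ∈ e
    · exact Or.inr ⟨monoEdges_subset G _ he, hu⟩
    · refine Or.inl (mem_filter.2 ⟨monoEdges_subset G _ he, fun x hx y hy => ?_⟩)
      rw [h x fun hxu => hu (hxu ▸ hx), h y fun hyu => hu (hyu ▸ hy)]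
      exact (mem_filter.1 he).2 x hx y hy
  have ha := exp_sub_one_nonneg hβ
  have hcard : ((monoEdges G σ).card : ℝ) ≤ (monoEdges G σ').card + G.degree u := by
    have := (card_le_card (hsub fun x hx => (h x hx).symm)).trans (card_union_le _ _)
    rw [G.card_incidenceFinset_eq_degree] at this
    exact_mod_cast this
  have h1 : clusterSum q (Real.exp β - 1) (monoEdges G σ' ∩ monoEdges G τ) ≤
      (q * Real.exp β) ^ G.degree u *
        clusterSum q (Real.exp β - 1) (monoEdges G σ ∩ monoEdges G τ) := by
    have h2 := clusterSum_union_le q ha (monoEdges G σ ∩ monoEdges G τ) (G.incidenceFinset u)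
    rw [G.card_incidenceFinset_eq_degree, add_sub_cancel] at h2
    refine (clusterSum_mono q ha fun e he => ?_).trans h2
    have h3 := hsub h (mem_inter.1 he).1
    rw [mem_union] at h3 ⊢
    exact h3.imp_left fun h4 => mem_inter.2 ⟨h4, (mem_inter.1 he).2⟩
  have h2 : Real.exp (-(β * (monoEdges G σ').card)) ≤
      Real.exp β ^ G.degree u * Real.exp (-(β * (monoEdges G σ).card)) := by
    rw [← Real.exp_nat_mul, ← Real.exp_add, Real.exp_le_exp]
    nlinarith
  rw [SW_eq, SW_eq]
  have h0 := clusterSum_nonneg q ha (monoEdges G σ ∩ monoEdges G τ)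
  calc _ ≤ (Real.exp β ^ G.degree u * Real.exp (-(β * (monoEdges G σ).card))) *
        ((q * Real.exp β) ^ G.degree u *
          clusterSum q (Real.exp β - 1) (monoEdges G σ ∩ monoEdges G τ)) :=
        mul_le_mul h2 h1 (clusterSum_nonneg q ha _) (by positivity)
    _ = _ := by
        rw [two_mul, Real.exp_add, mul_pow, mul_pow, mul_pow]; ring

end Potts

section Conditional

lemma exists_eq_off_of_card_ne_eq_one {V : Type*} [Fintype V] {q : ℕ} {v : V} {k : Fin q} {σ τ : {σ : V → Fin q // σ v = k}}
    (h : (univ.filter fun u => σ.1 u ≠ τ.1 u).card = 1) :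
    ∃ u, u ≠ v ∧ ∀ x, x ≠ u → σ.1 x = τ.1 x := by
  obtain ⟨u, hu⟩ := card_eq_one.1 h
  refine ⟨u, ?_, fun x hx => ?_⟩
  · rintro rfl
    have : u ∈ univ.filter fun u => σ.1 u ≠ τ.1 u := by simp [hu]
    exact (mem_filter.1 this).2 (σ.2.trans τ.2.symm)
  · by_contra hne
    have : x ∈ univ.filter fun u => σ.1 u ≠ τ.1 u := by simp [hne]
    exact hx (by simpa [hu] using this)

variable {V : Type*} [Fintype V] [DecidableEq V] {q : ℕ}

/-- A coloring is uniquely a global color shift of a coloring giving `v` the color `k`. -/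
def shiftEquiv [NeZero q] (v : V) (k : Fin q) :
    {σ : V → Fin q // σ v = k} × Fin q ≃ (V → Fin q) where
  toFun p := fun x => p.1.1 x + p.2
  invFun τ := (⟨fun x => τ x - (τ v - k), by simp⟩, τ v - k)
  left_inv := by
    rintro ⟨⟨σ, hσ⟩, g⟩
    ext <;> simp [hσ]
  right_inv τ := by simp

lemma sum_eq_sum_shift [NeZero q] (v : V) (k : Fin q) (F : (V → Fin q) → ℝ) :
    ∑ σ, F σ = ∑ σ : {σ : V → Fin q // σ v = k}, ∑ g, F (fun x => σ.1 x + g) := by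
  rw [← (shiftEquiv v k).sum_comp, Fintype.sum_prod_type]
  rfl

variable (G : SimpleGraph V) [DecidableRel G.Adj]

lemma potts_add_const [NeZero q] (β : ℝ) (σ : V → Fin q) (g : Fin q) :
    potts G β q (fun x => σ x + g) = potts G β q σ := by
  simp only [potts, monoEdges_add_const]

lemma SW_add_const [NeZero q] (β : ℝ) (σ τ : V → Fin q) (g h : Fin q) :
    SW G β q (fun x => σ x + g) (fun x => τ x + h) = SW G β q σ τ := by
  simp only [SW, monoEdges_add_const]

lemma condPotts_eq [NeZero q] (β : ℝ) (v : V) (k : Fin q) (σ : {σ : V → Fin q // σ v = k}) :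
    condPotts G β q v k σ = q * potts G β q σ.1 := by
  have hq : (q : ℝ) ≠ 0 := by exact_mod_cast NeZero.ne q
  have h := sum_eq_sum_shift v k (potts G β q)
  simp only [sum_potts, potts_add_const, sum_const, card_univ, Fintype.card_fin,
    nsmul_eq_mul] at h
  rw [← mul_sum] at h
  rw [condPotts, eq_div_of_mul_eq hq (mul_comm _ _ |>.trans h.symm), div_div_eq_mul_div, div_one,
    mul_comm]

lemma condPotts_pos [NeZero q] (β : ℝ) (v : V) (k : Fin q) (σ : {σ : V → Fin q // σ v = k}) :
    0 < condPotts G β q v k σ := by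
  rw [condPotts_eq]
  exact mul_pos (by exact_mod_cast NeZero.pos q) (potts_pos G β _)

/-- The Swendsen–Wang chain observed up to global color shifts. -/
def condSW (β : ℝ) (q : ℕ) (v : V) (k : Fin q) (σ τ : {σ : V → Fin q // σ v = k}) : ℝ :=
  q * SW G β q σ.1 τ.1

lemma detailedBalance_condSW [NeZero q] (β : ℝ) (v : V) (k : Fin q) :
    DetailedBalance (condPotts G β q v k) (condSW G β q v k) := fun σ τ => by
  have := detailedBalance_SW G β σ.1 τ.1
  rw [condPotts_eq, condPotts_eq, condSW, condSW]
  linear_combination (q : ℝ) ^ 2 * this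

lemma condSW_nonneg {β : ℝ} (hβ : 0 ≤ β) (v : V) (k : Fin q)
    (σ τ : {σ : V → Fin q // σ v = k}) : 0 ≤ condSW G β q v k σ τ :=
  mul_nonneg (Nat.cast_nonneg _) (SW_nonneg G hβ _ _)

lemma sum_condSW [NeZero q] (β : ℝ) (v : V) (k : Fin q) (σ : {σ : V → Fin q // σ v = k}) :
    ∑ τ, condSW G β q v k σ τ = 1 := by
  rw [← sum_SW G β σ.1, sum_eq_sum_shift v k]
  refine sum_congr rfl fun τ _ => ?_
  have : ∀ g, SW G β q σ.1 (fun x => τ.1 x + g) = SW G β q σ.1 τ.1 := fun g => by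
    simpa using SW_add_const G β σ.1 τ.1 0 g
  simp [this, condSW]

/-- Average of `f` over global color shifts. -/
def shiftAverage (v : V) (k : Fin q) (f : (V → Fin q) → ℝ) (σ : {σ : V → Fin q // σ v = k}) :
    ℝ :=
  (∑ g, f fun x => σ.1 x + g) / q

lemma sum_condPotts_mul_shiftAverage [NeZero q] (β : ℝ) (v : V) (k : Fin q)
    (f : (V → Fin q) → ℝ) :
    ∑ σ, condPotts G β q v k σ * shiftAverage v k f σ = ∑ σ, potts G β q σ * f σ := by
  have hq : (q : ℝ) ≠ 0 := by exact_mod_cast NeZero.ne q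
  rw [sum_eq_sum_shift v k]
  refine sum_congr rfl fun σ _ => ?_
  simp only [potts_add_const, ← mul_sum, condPotts_eq, shiftAverage]
  field_simp

lemma wInner_shiftAverage_le [NeZero q] (β : ℝ) (v : V) (k : Fin q) (f : (V → Fin q) → ℝ) :
    wInner (condPotts G β q v k) (shiftAverage v k f) (shiftAverage v k f) ≤
      wInner (potts G β q) f f := by
  have hq : (0 : ℝ) < q := by exact_mod_cast NeZero.pos q
  rw [wInner, wInner, sum_eq_sum_shift v k]
  refine sum_le_sum fun σ _ => ?_
  have h := sq_sum_le_card_mul_sum_sq (s := univ) (f := fun g => f fun x => σ.1 x + g)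
  simp only [potts_add_const, ← sum_mul, condPotts_eq, shiftAverage, ← sq]
  rw [card_univ, Fintype.card_fin] at h
  have hπ := potts_pos G β σ.1
  rw [← mul_assoc]
  refine mul_le_mul_of_nonneg_right ?_ hπ.le
  rw [div_pow, div_mul_eq_mul_div, div_le_iff₀ (by positivity)]
  nlinarith

lemma wInner_condSW_shiftAverage [NeZero q] (β : ℝ) (v : V) (k : Fin q)
    (f : (V → Fin q) → ℝ) :
    wInner (condPotts G β q v k) (kernelAct (condSW G β q v k) (shiftAverage v k f))
        (shiftAverage v k f) =
      wInner (potts G β q) (kernelAct (SW G β q) f) f := by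
  have hq : (q : ℝ) ≠ 0 := by exact_mod_cast NeZero.ne q
  rw [wInner_kernelAct, wInner_kernelAct, sum_eq_sum_shift v k]
  refine sum_congr rfl fun σ _ => ?_
  simp only [sum_eq_sum_shift v k (fun τ => potts G β q _ * SW G β q _ τ * _)]
  rw [sum_comm]
  refine sum_congr rfl fun τ _ => ?_
  simp only [potts_add_const, SW_add_const, ← mul_sum, ← sum_mul, condPotts_eq, condSW,
    shiftAverage]
  field_simp

lemma PLamOff_nonneg [NeZero q] (hN : 2 ≤ Fintype.card V) (β : ℝ) (v : V) (k : Fin q)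
    (σ τ : {σ : V → Fin q // σ v = k}) : 0 ≤ PLamOff G β q v k σ τ := by
  have hN' : (2 : ℝ) ≤ Fintype.card V := by exact_mod_cast hN
  have h1 := potts_pos G β σ.1
  have h2 := potts_pos G β τ.1
  have : (0 : ℝ) ≤ (Fintype.card V : ℝ) - 1 := by linarith
  rw [PLamOff]
  split_ifs <;> positivity

lemma sum_PLamOff_le [NeZero q] (hN : 2 ≤ Fintype.card V) (β : ℝ) (v : V) (k : Fin q)
    (σ : {σ : V → Fin q // σ v = k}) : ∑ τ, PLamOff G β q v k σ τ ≤ q := by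
  have hN' : (2 : ℝ) ≤ Fintype.card V := by exact_mod_cast hN
  set S := univ.filter fun τ : {σ : V → Fin q // σ v = k} =>
    (univ.filter fun u => σ.1 u ≠ τ.1 u).card = 1 with hS
  have hcard : S.card ≤ (Fintype.card V - 1) * q := by
    have hsub : S.image Subtype.val ⊆ ((univ.erase v) ×ˢ (univ : Finset (Fin q))).image
        fun p => Function.update σ.1 p.1 p.2 := by
      intro τ hτ
      obtain ⟨τ, hτ', rfl⟩ := mem_image.1 hτ
      obtain ⟨u, hu, h⟩ := exists_eq_off_of_card_ne_eq_one (mem_filter.1 hτ').2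
      refine mem_image.2 ⟨(u, τ.1 u), by simp [hu], ?_⟩
      funext x
      by_cases hx : x = u
      · simp [hx]
      · simp [hx, h x hx]
    have := (card_le_card hsub).trans card_image_le
    rwa [card_image_of_injective _ Subtype.val_injective, card_product, card_univ,
      Fintype.card_fin, card_erase_of_mem (mem_univ v), card_univ] at this
  have hle : ∀ τ, PLamOff G β q v k σ τ ≤
      if (univ.filter fun u => σ.1 u ≠ τ.1 u).card = 1 then ((Fintype.card V : ℝ) - 1)⁻¹ else 0 := by
    intro τ
    rw [PLamOff]
    split_ifs
    · refine mul_le_of_le_one_right (inv_nonneg.2 (by linarith)) (inv_le_one_of_one_le₀ ?_)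
      linarith [div_pos (potts_pos G β σ.1) (potts_pos G β τ.1)]
    · exact le_rfl
  refine (sum_le_sum fun τ _ => hle τ).trans ?_
  rw [← sum_filter, sum_const, nsmul_eq_mul, ← div_eq_mul_inv, div_le_iff₀ (by linarith)]
  have h2 : ((Fintype.card V - 1 : ℕ) : ℝ) = (Fintype.card V : ℝ) - 1 := by
    rw [Nat.cast_sub (by omega), Nat.cast_one]
  rw [← h2, mul_comm]
  exact_mod_cast hcard

lemma sum_PLam (β : ℝ) (v : V) (k : Fin q) (σ : {σ : V → Fin q // σ v = k}) :
    ∑ τ, PLam G β q v k σ τ = 1 := by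
  have h : ∑ τ ∈ univ.erase σ, PLam G β q v k σ τ =
      ∑ τ ∈ univ.erase σ, PLamOff G β q v k σ τ :=
    sum_congr rfl fun τ hτ => if_neg (ne_of_mem_erase hτ).symm
  rw [← add_sum_erase _ _ (mem_univ σ), h, PLam, if_pos rfl, sub_add_cancel]

lemma sum_abs_PLam_le [NeZero q] (hN : 2 ≤ Fintype.card V) (β : ℝ) (v : V) (k : Fin q)
    (σ : {σ : V → Fin q // σ v = k}) : ∑ τ, |PLam G β q v k σ τ| ≤ 1 + 2 * q := by
  have h1 : ∑ τ ∈ univ.erase σ, |PLam G β q v k σ τ| =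
      ∑ τ ∈ univ.erase σ, PLamOff G β q v k σ τ := sum_congr rfl fun τ hτ => by
    rw [PLam, if_neg (ne_of_mem_erase hτ).symm, abs_of_nonneg (PLamOff_nonneg G hN β v k σ τ)]
  have h2 : ∑ τ ∈ univ.erase σ, PLamOff G β q v k σ τ ≤ q :=
    (sum_le_sum_of_subset_of_nonneg (subset_univ _)
      fun τ _ _ => PLamOff_nonneg G hN β v k σ τ).trans (sum_PLamOff_le G hN β v k σ)
  have h3 : 0 ≤ ∑ τ ∈ univ.erase σ, PLamOff G β q v k σ τ :=
    sum_nonneg fun τ _ => PLamOff_nonneg G hN β v k σ τ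
  rw [← add_sum_erase _ _ (mem_univ σ), h1, PLam, if_pos rfl]
  have h4 : |1 - ∑ τ ∈ univ.erase σ, PLamOff G β q v k σ τ| ≤ 1 + q :=
    abs_le.2 ⟨by linarith, by linarith⟩
  linarith

lemma detailedBalance_PLam [NeZero q] (β : ℝ) (v : V) (k : Fin q) :
    DetailedBalance (condPotts G β q v k) (PLam G β q v k) := fun σ τ => by
  by_cases h : σ = τ
  · rw [h]
  rw [PLam, PLam, if_neg h, if_neg (Ne.symm h), PLamOff, PLamOff, condPotts_eq, condPotts_eq]
  simp only [ne_comm (a := τ.1 _)]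
  have h1 := potts_pos G β σ.1
  have h2 := potts_pos G β τ.1
  split_ifs
  · have h3 := (add_pos h1 h2).ne'
    have h4 : (1 + potts G β q σ.1 / potts G β q τ.1)⁻¹ =
        potts G β q τ.1 / (potts G β q σ.1 + potts G β q τ.1) := by
      field_simp; ring
    have h5 : (1 + potts G β q τ.1 / potts G β q σ.1)⁻¹ =
        potts G β q σ.1 / (potts G β q σ.1 + potts G β q τ.1) := by
      field_simp
    rw [h4, h5]
    ring
  · simp

lemma exists_eq_off_of_PLam_ne_zero (hN : 2 ≤ Fintype.card V) {β : ℝ} {v : V} {k : Fin q}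
    {σ τ : {σ : V → Fin q // σ v = k}} (h : PLam G β q v k σ τ ≠ 0) :
    ∃ u, u ≠ v ∧ ∀ x, x ≠ u → σ.1 x = τ.1 x := by
  by_cases hστ : σ = τ
  · have : Nontrivial V := Fintype.one_lt_card_iff_nontrivial.1 hN
    obtain ⟨u, hu⟩ := exists_ne v
    exact ⟨u, hu, fun x _ => by rw [hστ]⟩
  · rw [PLam, if_neg hστ, PLamOff] at h
    exact exists_eq_off_of_card_ne_eq_one (by_contra fun h' => h (if_neg h'))

lemma opNorm_SW_eq_zero [NeZero q] (β : ℝ) (hG : G.edgeFinset = ∅) :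
    opNorm (potts G β q) (fun σ τ => SW G β q σ τ - potts G β q τ) = 0 := by
  have hmono : ∀ σ : V → Fin q, monoEdges G σ = ∅ := fun σ =>
    subset_empty.1 (hG ▸ monoEdges_subset G σ)
  have hSW : ∀ σ τ : V → Fin q, SW G β q σ τ = potts G β q τ := fun σ τ => by
    have h1 := detailedBalance_SW G β τ σ
    have hconst : ∀ ρ ρ' : V → Fin q, potts G β q ρ = potts G β q ρ' := by simp [potts, hmono]
    have h2 : ∀ ρ, SW G β q σ ρ = SW G β q σ τ := by simp [SW, hmono]
    have h3 := sum_SW G β σ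
    have h4 := sum_potts G (q := q) β
    simp only [h2] at h3
    simp only [hconst _ τ] at h4
    rw [sum_const, nsmul_eq_mul] at h3 h4
    have h5 : ((univ : Finset (V → Fin q)).card : ℝ) ≠ 0 := fun h0 => by
      rw [h0, zero_mul] at h3
      exact zero_ne_one h3
    exact mul_left_cancel₀ h5 (h3.trans h4.symm)
  refine le_antisymm (opNorm_le le_rfl fun f => ?_) (opNorm_nonneg _ _)
  simp [kernelAct, hSW, wInner]

/-- The spectral gap comparison with an explicit entrywise constant `C`. -/
lemma div_le_specGap_SW [NeZero q] {β : ℝ} (hβ : 0 ≤ β) (v : V) (k : Fin q) {C : ℝ} (hC1 : 1 ≤ C)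
    (hC : ∀ σ τ, matMul (PLam G β q v k) (matMul (condSW G β q v k) (PLam G β q v k)) σ τ ≤
      C * condSW G β q v k σ τ) :
    specGap (condPotts G β q v k) (matMul (PLam G β q v k) (PLam G β q v k)) / C ≤
      specGap (potts G β q) (SW G β q) := by
  set lam := specGap (condPotts G β q v k) (matMul (PLam G β q v k) (PLam G β q v k)) with hlam
  have hC0 : 0 < C := by linarith
  have hκ : 0 ≤ 1 - lam / C := by
    have : lam / C ≤ 1 := (div_le_one hC0).2 ((specGap_le_one _ _).trans hC1)
    linarith
  have hπ : ∀ σ, 0 ≤ potts G β q σ := fun σ => (potts_pos G β σ).le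
  have hform : ∀ f : (V → Fin q) → ℝ, ∃ f₀ : (V → Fin q) → ℝ, ∑ σ, potts G β q σ * f₀ σ = 0 ∧
      wInner (potts G β q) f₀ f₀ ≤ wInner (potts G β q) f f ∧
      wInner (potts G β q) (kernelAct (fun σ τ => SW G β q σ τ - potts G β q τ) f) f =
        wInner (potts G β q) (kernelAct (SW G β q) f₀) f₀ := by
    intro f
    set m := ∑ σ, potts G β q σ * f σ with hm
    have hPm : kernelAct (SW G β q) (fun σ => f σ - m) =
        fun σ => kernelAct (SW G β q) f σ - m := by
      funext σ
      simp only [kernelAct, mul_sub, sum_sub_distrib, ← sum_mul, sum_SW, one_mul]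
    have hmean : wInner (potts G β q) f (fun _ => m) = m * m := by
      rw [wInner]
      nth_rewrite 2 [hm]
      rw [mul_sum]
      exact sum_congr rfl fun σ _ => by ring
    have hone : wInner (potts G β q) (fun _ => m) (fun _ => m) = m * m := by
      rw [wInner, ← mul_sum, sum_potts, mul_one]
    have hP1 : wInner (potts G β q) (kernelAct (SW G β q) f) (fun _ => m) = m * m := by
      rw [(detailedBalance_SW G β).wInner_kernelAct_symm, ← hmean]
      congr 1
      funext σ
      simp only [kernelAct, ← sum_mul, sum_SW, one_mul]
    have hsub : ∀ h : (V → Fin q) → ℝ,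
        wInner (potts G β q) (fun σ => h σ - m) (fun σ => f σ - m) =
          wInner (potts G β q) h f - wInner (potts G β q) h (fun _ => m) -
          wInner (potts G β q) f (fun _ => m) +
          wInner (potts G β q) (fun _ => m) (fun _ => m) := fun h => by
      simp only [wInner, ← sum_add_distrib, ← sum_sub_distrib]
      exact sum_congr rfl fun σ _ => by ring
    refine ⟨fun σ => f σ - m, ?_, ?_, ?_⟩
    · simp only [mul_sub, sum_sub_distrib, ← sum_mul, sum_potts, one_mul, ← hm, sub_self]
    · rw [hsub, hmean, hone]
      nlinarith [mul_self_nonneg m]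
    · rw [hPm, hsub, hP1, hmean, hone]
      have : kernelAct (fun σ τ => SW G β q σ τ - potts G β q τ) f =
          fun σ => kernelAct (SW G β q) f σ - m := by
        funext σ
        simp only [kernelAct, sub_mul, sum_sub_distrib, ← hm]
      have h2 : wInner (potts G β q) (fun σ => kernelAct (SW G β q) f σ - m) f =
          wInner (potts G β q) (kernelAct (SW G β q) f) f -
            wInner (potts G β q) f (fun _ => m) := by
        simp only [wInner, ← sum_sub_distrib]
        exact sum_congr rfl fun σ _ => by ring
      rw [this, h2, hmean]
      ring
  have hop : opNorm (potts G β q) (fun σ τ => SW G β q σ τ - potts G β q τ) ≤ 1 - lam / C := by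
    refine opNorm_le_of_form_le hπ (fun σ τ => ?_) hκ (fun f => ?_) fun f => ?_
    · rw [mul_sub, mul_sub, detailedBalance_SW G β σ τ, mul_comm (potts G β q σ)]
    · obtain ⟨f₀, -, -, h⟩ := hform f
      rw [h]
      exact SW_form_nonneg G hβ f₀
    · obtain ⟨f₀, hmean, hle, h⟩ := hform f
      have hgap := specGap_mul_le_dirichlet (condPotts_pos G β v k) (detailedBalance_PLam G β v k)
        (detailedBalance_condSW G β v k) (sum_PLam G β v k) (sum_condSW G β v k)
        (condSW_nonneg G hβ v k) hC (g := shiftAverage v k f₀)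
        (by rw [sum_condPotts_mul_shiftAverage, hmean])
      rw [wInner_condSW_shiftAverage, ← hlam] at hgap
      have h1 := wInner_shiftAverage_le G β v k f₀
      rw [h]
      set a := wInner (condPotts G β q v k) (shiftAverage v k f₀) (shiftAverage v k f₀)
      refine le_trans ?_ (mul_le_mul_of_nonneg_left (h1.trans hle) hκ)
      rw [← div_le_iff₀' hC0, mul_div_right_comm] at hgap
      linarith
  rw [specGap]
  linarith

end Conditional

/-- Theorem 1′: with `Δ̃` the maximum degree over vertices `≠ v`,
`λ(P) ≥ (2q²)⁻¹ (q e^{2β})^{-4Δ̃} · λ(P_{Λ_v^k}²)`. -/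
theorem swendsen_wang_gap_ge_conditional_heat_bath_gap
    {V : Type*} [Fintype V] [DecidableEq V]
    (G : SimpleGraph V) [DecidableRel G.Adj] (hN : 2 ≤ Fintype.card V)
    (q : ℕ) (hq : 2 ≤ q) (β : ℝ) (hβ : 0 ≤ β) (v : V) (k : Fin q) :
    specGap (potts G β q) (SW G β q) ≥
      (1 / (2 * (q : ℝ) ^ 2)) *
        ((q : ℝ) * Real.exp (2 * β)) ^ (-(4 * (((Finset.univ.erase v).sup (fun u => G.degree u) : ℕ) : ℤ))) *
        specGap (condPotts G β q v k) (matMul (PLam G β q v k) (PLam G β q v k)) := by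
  have hq2 : (2 : ℝ) ≤ q := by exact_mod_cast hq
  have : NeZero q := ⟨by omega⟩
  set D := (univ.erase v).sup fun u => G.degree u with hD
  set B : ℝ := q * Real.exp (2 * β) with hB
  set lam := specGap (condPotts G β q v k) (matMul (PLam G β q v k) (PLam G β q v k))
  have hqB : (q : ℝ) ≤ B :=
    le_mul_of_one_le_right (by linarith) (Real.one_le_exp (by linarith))
  have hB1 : 1 ≤ B := by linarith
  have hDB : 1 ≤ B ^ D := one_le_pow₀ hB1
  set C : ℝ := 2 * (q : ℝ) ^ 2 * (B ^ D) ^ 4 with hCdef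
  have hC1 : 1 ≤ C := by
    have h1 : (1 : ℝ) ≤ 2 * (q : ℝ) ^ 2 := by nlinarith
    exact one_le_mul_of_one_le_of_one_le h1 (one_le_pow₀ hDB)
  have hconst : 1 / (2 * (q : ℝ) ^ 2) * B ^ (-(4 * (D : ℤ))) * lam = lam / C := by
    have : B ^ (-(4 * (D : ℤ))) = ((B ^ D) ^ 4)⁻¹ := by
      rw [zpow_neg, ← pow_mul, mul_comm D 4, ← zpow_natCast]
      push_cast
      rfl
    rw [this, hCdef]
    field_simp
  rw [ge_iff_le, hconst]
  rcases Nat.eq_zero_or_pos D with hD0 | hD0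
  · have hG : G.edgeFinset = ∅ := by
      have hdeg : ∀ u, u ≠ v → G.degree u = 0 := fun u hu => by
        have : G.degree u ≤ D := le_sup (f := fun u => G.degree u) (by simp [hu])
        omega
      have hadj : ∀ x y, x ≠ v → ¬ G.Adj x y := fun x y hx h =>
        (G.degree_pos_iff_exists_adj x |>.2 ⟨y, h⟩).ne' (hdeg x hx)
      refine eq_empty_of_forall_notMem fun e he => ?_
      induction e using Sym2.ind with
      | h x y =>
        rw [SimpleGraph.mem_edgeFinset, SimpleGraph.mem_edgeSet] at he
        by_cases hx : x = v
        · exact hadj y x (fun hy => he.ne (hx.trans hy.symm)) he.symm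
        · exact hadj x y hx he
    rw [specGap, opNorm_SW_eq_zero G β hG, sub_zero]
    exact (div_le_one (by linarith)).2 ((specGap_le_one _ _).trans hC1)
  · refine div_le_specGap_SW G hβ v k hC1 fun σ τ => ?_
    refine (matMul_conj_le (condPotts_pos G β v k) (detailedBalance_PLam G β v k)
      (detailedBalance_condSW G β v k) (condSW_nonneg G hβ v k) (K := B ^ D) (by positivity)
      (sum_abs_PLam_le G hN β v k) (fun σ σ' τ h => ?_) σ τ).trans
      (mul_le_mul_of_nonneg_right ?_ (condSW_nonneg G hβ v k σ τ))
    · obtain ⟨u, hu, hσ⟩ := exists_eq_off_of_PLam_ne_zero G hN h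
      have hdeg : G.degree u ≤ D := le_sup (f := fun u => G.degree u) (by simp [hu])
      have h1 : SW G β q σ'.1 τ.1 ≤ B ^ D * SW G β q σ.1 τ.1 :=
        (SW_le_of_eq_off G hβ hσ τ.1).trans
          (mul_le_mul_of_nonneg_right (pow_le_pow_right₀ hB1 hdeg) (SW_nonneg G hβ _ _))
      rw [condSW, condSW, mul_left_comm]
      exact mul_le_mul_of_nonneg_left h1 (Nat.cast_nonneg q)
    · have hqK : (q : ℝ) ≤ B ^ D := hqB.trans (le_self_pow₀ hB1 hD0.ne')
      have h1 : (1 + 2 * (q : ℝ)) ^ 2 ≤ 2 * (q : ℝ) ^ 2 * (q : ℝ) ^ 2 := by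
        nlinarith [mul_nonneg (sub_nonneg.2 hq2) (sub_nonneg.2 hq2), sq_nonneg ((q : ℝ) ^ 2 - 4)]
      have h2 : (q : ℝ) ^ 2 ≤ (B ^ D) ^ 2 := by gcongr
      calc ((1 + 2 * (q : ℝ)) * B ^ D) ^ 2 = (1 + 2 * (q : ℝ)) ^ 2 * (B ^ D) ^ 2 := mul_pow _ _ _
        _ ≤ 2 * (q : ℝ) ^ 2 * (B ^ D) ^ 2 * (B ^ D) ^ 2 :=
            mul_le_mul_of_nonneg_right (h1.trans (by gcongr)) (sq_nonneg _)
        _ = C := by rw [hCdef]; ring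

end
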